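/- arXiv:2507.06099 — 2 statements merged into one kernel-verified Lean document; each statement's English description precedes it below -/
import Mathlib

section
/- Let A be a commutative ring with a surjective ring map to B with kernel K, where A is a polynomial algebra over B split by a section B → A. Suppose m is a positive integer such that every element of K^{m·n} can be written as a product of an element of K^m and an element of K^{m(n-1)} (sharing property). Then for all p ≥ 1 and n ≥ 2, the map Tor_p^A(A/K^m, A/(K^m)^n) → Tor_p^A(A/K^m, A/(K^m)^{n−1}) induced by the quotient A/(K^m)^n → A/(K^m)^{n−1} is zero. -/
open CategoryTheory

namespace TorAux
variable {A : Type} [CommRing A]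

abbrev mulHom (a : A) : ModuleCat.of A A ⟶ ModuleCat.of A A :=
  ModuleCat.ofHom (LinearMap.mulLeft A a)

def kX (A : Type) [CommRing A] : ℕ → ModuleCat.{0} A
  | 0 => ModuleCat.of A A
  | 1 => ModuleCat.of A A
  | _ + 2 => ModuleCat.of A PUnit

def kd (a : A) : (i j : ℕ) → (kX A i ⟶ kX A j)
  | 1, 0 => mulHom a
  | 0, _ => 0
  | 1, _ + 1 => 0
  | _ + 2, _ => 0

def kos (a : A) : ChainComplex (ModuleCat.{0} A) ℕ where
  X := kX A
  d := kd a
  shape i j h := by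
    match i, j, h with
    | 1, 0, h => exact absurd rfl h
    | 0, _, _ => rfl
    | 1, _ + 1, _ => rfl
    | _ + 2, _, _ => rfl
  d_comp_d' i j k _ _ := by
    match i, j, k with
    | 0, _, _ => exact Limits.zero_comp
    | 1, _ + 1, _ => exact Limits.zero_comp
    | _ + 2, _, _ => exact Limits.zero_comp
    | 1, 0, _ => exact Limits.comp_zero

def kaug (I : Ideal A) : ModuleCat.of A A ⟶ ModuleCat.of A (A ⧸ I) :=
  ModuleCat.ofHom (Submodule.mkQ I)

lemma kaug_zero (a : A) (I : Ideal A) (hI : I = Ideal.span {a}) :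
    mulHom a ≫ kaug I = 0 := by
  ext
  show Ideal.Quotient.mk I (a * 1) = 0
  rw [Ideal.Quotient.eq_zero_iff_mem, hI]
  exact Ideal.mem_span_singleton.2 ⟨1, rfl⟩

noncomputable def kpi (a : A) (I : Ideal A) (hI : I = Ideal.span {a}) :
    kos a ⟶ (ChainComplex.single₀ (ModuleCat.{0} A)).obj (ModuleCat.of A (A ⧸ I)) :=
  (ChainComplex.toSingle₀Equiv _ _).symm ⟨kaug I, kaug_zero a I hI⟩

lemma kpi_f_zero (a : A) (I : Ideal A) (hI : I = Ideal.span {a}) :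
    (kpi a I hI).f 0 = kaug I :=
  ChainComplex.toSingle₀Equiv_symm_apply_f_zero _ _

lemma k_exact0 (a : A) (I : Ideal A) (hI : I = Ideal.span {a}) :
    (ShortComplex.mk (mulHom a) (kaug I) (kaug_zero a I hI)).Exact := by
  rw [ShortComplex.moduleCat_exact_iff]
  intro x hx
  have h1 : x ∈ I := Ideal.Quotient.eq_zero_iff_mem.1 hx
  have h2 : ∀ y : A, y ∈ I → a ∣ y := fun y hy => Ideal.mem_span_singleton.1 (hI ▸ hy)
  obtain ⟨c, hc⟩ := h2 x h1
  exact ⟨c, hc.symm⟩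

noncomputable def kres (a : A) (ha : ∀ x, a * x = 0 → x = 0) (I : Ideal A) (hI : I = Ideal.span {a}) :
    ProjectiveResolution (ModuleCat.of A (A ⧸ I)) where
  complex := kos a
  projective n := by
    match n with
    | 0 => exact inferInstanceAs (Projective (ModuleCat.of A A))
    | 1 => exact inferInstanceAs (Projective (ModuleCat.of A A))
    | n + 2 => exact inferInstanceAs (Projective (ModuleCat.of A PUnit))
  π := kpi a I hI
  quasiIso := ⟨fun n => by
    match n with
    | 0 =>
      rw [ChainComplex.quasiIsoAt₀_iff, ShortComplex.quasiIso_iff_of_zeros']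
      · refine (ShortComplex.exact_and_epi_g_iff_of_iso ?_).2
          ⟨k_exact0 a I hI, (ModuleCat.epi_iff_surjective _).2 (Submodule.mkQ_surjective I)⟩
        exact ShortComplex.isoMk (Iso.refl _) (Iso.refl _) (Iso.refl _)
          ((Category.id_comp _).trans (Category.comp_id _).symm)
          ((Category.id_comp _).trans ((kpi_f_zero a I hI).symm.trans (Category.comp_id _).symm))
      all_goals rfl
    | n + 1 =>
      rw [quasiIsoAt_iff_exactAt' (hL := ChainComplex.exactAt_succ_single_obj ..),
          HomologicalComplex.exactAt_iff' _ (n + 2) (n + 1) n (by simp) (by simp),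
          ShortComplex.moduleCat_exact_iff]
      match n with
      | 0 =>
        intro x hx
        exact ⟨0, (map_zero _).trans (ha x hx).symm⟩
      | n + 1 =>
        intro x hx
        exact ⟨0, Subsingleton.elim (α := PUnit) _ _⟩⟩

def kmap_f (c : A) : (n : ℕ) → (kX A n ⟶ kX A n)
  | 0 => 𝟙 _
  | 1 => mulHom c
  | _ + 2 => 0

def kmap (a b c : A) (h : a = b * c) : kos a ⟶ kos b where
  f := kmap_f c
  comm' i j hij := by
    match i, j with
    | 0, _ => exact Limits.comp_zero.trans Limits.zero_comp.symm
    | 1, _ + 1 => exact Limits.comp_zero.trans Limits.zero_comp.symm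
    | _ + 2, _ => exact Limits.zero_comp.trans Limits.zero_comp.symm
    | 1, 0 =>
      subst h
      show mulHom c ≫ mulHom b = mulHom (b * c) ≫ 𝟙 _
      ext
      show b * (c * 1) = (b * c) * 1
      ring

open MonoidalCategory in
lemma tor_zero (a b c : A) (h : a = b * c) (ha : ∀ x, a * x = 0 → x = 0)
    (hb : ∀ x, b * x = 0 → x = 0) (I J L : Ideal A) (hI : I = Ideal.span {a})
    (hJ : J = Ideal.span {b}) (hc : c ∈ L)
    (f : ModuleCat.of A (A ⧸ I) ⟶ ModuleCat.of A (A ⧸ J))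
    (hf : ∀ x : A, f (Ideal.Quotient.mk I x) = Ideal.Quotient.mk J x) (p : ℕ) (hp : 1 ≤ p) :
    ((Tor (ModuleCat A) p).obj (ModuleCat.of A (A ⧸ L))).map f = 0 := by
  obtain ⟨p, rfl⟩ : ∃ q, p = q + 1 := ⟨p - 1, by omega⟩
  have w : kmap a b c h ≫ (kres b hb J hJ).π =
      (kres a ha I hI).π ≫ (ChainComplex.single₀ _).map f := by
    apply (ChainComplex.toSingle₀Equiv _ _).injective
    apply Subtype.ext
    show 𝟙 _ ≫ (kpi b J hJ).f 0 = (kpi a I hI).f 0 ≫ ((ChainComplex.single₀ _).map f).f 0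
    rw [kpi_f_zero, kpi_f_zero, ChainComplex.single₀_map_f_zero]
    erw [Category.id_comp]
    ext
    exact (hf 1).symm
  have key := Functor.leftDerived_map_eq ((tensoringLeft (ModuleCat A)).obj (ModuleCat.of A (A ⧸ L)))
    (p + 1) f (P := kres a ha I hI) (Q := kres b hb J hJ) (kmap a b c h) w
  refine key.trans ?_
  have hz : (ModuleCat.of A (A ⧸ L)) ◁ ((kmap a b c h).f (p + 1)) = 0 := by
    match p with
    | 0 =>
      show (ModuleCat.of A (A ⧸ L)) ◁ (mulHom c) = 0
      have : ∀ x : A ⧸ L, c • x = 0 := by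
        intro x
        obtain ⟨x, rfl⟩ := Ideal.Quotient.mk_surjective x
        show Ideal.Quotient.mk L (c * x) = 0
        exact Ideal.Quotient.eq_zero_iff_mem.2 (L.mul_mem_right _ hc)
      ext1
      apply TensorProduct.ext'
      intro x y
      show TensorProduct.tmul A x (c * y) = 0
      rw [← smul_eq_mul, ← TensorProduct.smul_tmul, this, TensorProduct.zero_tmul]
    | p + 1 => exact MonoidalPreadditive.whiskerLeft_zero
  have : (((tensoringLeft (ModuleCat A)).obj (ModuleCat.of A (A ⧸ L))).mapHomologicalComplex _ ⋙
      HomologicalComplex.homologyFunctor _ _ (p + 1)).map (kmap a b c h) = 0 := by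
    show HomologicalComplex.homologyMap _ (p + 1) = 0
    rw [← cancel_epi (HomologicalComplex.homologyπ _ _),
      HomologicalComplex.homologyπ_naturality]
    have : HomologicalComplex.cyclesMap
        ((((tensoringLeft (ModuleCat A)).obj (ModuleCat.of A (A ⧸ L))).mapHomologicalComplex _).map
          (kmap a b c h)) (p + 1) = 0 := by
      rw [← cancel_mono (HomologicalComplex.iCycles _ _), HomologicalComplex.cyclesMap_i]
      exact ((congrArg (_ ≫ ·) hz).trans Limits.comp_zero).trans Limits.zero_comp.symm
    rw [this]
    exact Limits.zero_comp.trans Limits.comp_zero.symm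
  erw [this]
  exact (congrArg (_ ≫ ·) Limits.zero_comp).trans Limits.comp_zero

end TorAux


namespace TorAux
section
open Polynomial

lemma irr (k : Type) [CommRing k] [IsDomain k] (N : ℕ) (hN : 0 < N) :
    Irreducible ((X : k[X][X]) ^ N + C (X ^ N * (X - C 1))) := by
  have hdeg : ((X : k[X][X]) ^ N + C (X ^ N * (X - C 1))).degree = (N : WithBot ℕ) :=
    degree_X_pow_add_C hN _
  have hmon : ((X : k[X][X]) ^ N + C (X ^ N * (X - C 1))).Monic :=
    monic_X_pow_add_C _ hN.ne'
  have hpr : Prime (X - C 1 : k[X]) := prime_X_sub_C 1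
  refine irreducible_of_eisenstein_criterion (P := Ideal.span {X - C 1})
    ((Ideal.span_singleton_prime hpr.ne_zero).2 hpr) ?_ ?_ ?_ ?_ hmon.isPrimitive
  · rw [hmon.leadingCoeff, Ideal.mem_span_singleton]
    exact fun h => hpr.not_isUnit (isUnit_of_dvd_one h)
  · intro n hn
    rw [hdeg] at hn
    have hn' : n < N := by exact_mod_cast hn
    rw [coeff_add, coeff_X_pow, if_neg hn'.ne, zero_add, coeff_C]
    split_ifs
    · exact Ideal.mem_span_singleton.2 (Dvd.intro_left _ rfl)
    · exact zero_mem _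
  · rw [hdeg]; exact_mod_cast hN
  · rw [coeff_add, coeff_X_pow, if_neg hN.ne, zero_add, coeff_C_zero, Ideal.span_singleton_pow,
      Ideal.mem_span_singleton, pow_two]
    intro h
    have h2 := (mul_dvd_mul_iff_right hpr.ne_zero).1 h
    rw [dvd_iff_isRoot] at h2
    simp [IsRoot] at h2

lemma subsingleton_of_share
    (A B : Type) [CommRing A] [CommRing B] [Nontrivial B]
    (π : A →+* B) (s : B →+* A) (hs : π.comp s = RingHom.id B)
    (σ : Type) (e : A ≃+* MvPolynomial σ B) (he : ∀ b : B, e (s b) = MvPolynomial.C b)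
    (m : ℕ) (hm : 0 < m)
    (hshare : ∀ x ∈ (RingHom.ker π) ^ (m * 2),
        ∃ y ∈ (RingHom.ker π) ^ m, ∃ z ∈ (RingHom.ker π) ^ m, x = y * z) :
    Subsingleton σ := by
  classical
  have hs' : ∀ b, π (s b) = b := fun b => RingHom.congr_fun hs b
  refine ⟨fun i j => ?_⟩
  by_contra hij
  obtain ⟨M, hM⟩ := Ideal.exists_maximal B
  let k := B ⧸ M
  let q : B →+* k := Ideal.Quotient.mk M
  let t : σ → A := fun l => e.symm (MvPolynomial.X l)
  let v : σ → k[X][X] := fun l =>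
    C (C (q (π (t l)))) + (if l = i then X else if l = j then C X else 0)
  let ψ : A →+* k[X][X] :=
    (MvPolynomial.eval₂Hom ((C.comp C).comp q) v).comp e.toRingHom
  have hψs : ∀ b, ψ (s b) = C (C (q b)) := by
    intro b
    simp [ψ, he]
  have hψt : ∀ l, ψ (t l) = v l := by
    intro l
    simp [ψ, t]
  let ε : k[X][X] →+* k := constantCoeff.comp constantCoeff
  have hcomp : ε.comp ψ = q.comp π := by
    have : (ε.comp ψ).comp e.symm.toRingHom = (q.comp π).comp e.symm.toRingHom := by
      apply MvPolynomial.ringHom_ext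
      · intro b
        have : e.symm (MvPolynomial.C b) = s b := by rw [← he]; simp
        show ε (ψ (e.symm _)) = q (π (e.symm _))
        rw [this, hψs, hs']
        simp [ε]
      · intro l
        show ε (ψ (t l)) = q (π (t l))
        rw [hψt]
        simp only [ε, v]
        split_ifs <;> simp
    ext a
    simpa using RingHom.congr_fun this (e a)
  have hker : ∀ y ∈ (RingHom.ker π) ^ m, ¬ IsUnit (ψ y) := by
    intro y hy hu
    have h1 : y ∈ RingHom.ker π := Ideal.pow_le_self hm.ne' hy
    have h2 := hu.map ε
    have h3 : ε (ψ y) = q (π y) := RingHom.congr_fun hcomp y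
    rw [h3, RingHom.mem_ker.1 h1, map_zero] at h2
    exact not_isUnit_zero h2
  let g : σ → A := fun l => t l - s (π (t l))
  have hg : ∀ l, g l ∈ RingHom.ker π := by
    intro l
    rw [RingHom.mem_ker]
    simp [g, hs']
  have hψi : ψ (g i) = X := by
    simp [g, hψt, hψs, v]
  have hψj : ψ (g j) = C X := by
    simp [g, hψt, hψs, v, Ne.symm hij]
  obtain ⟨y, hy, z, hz, hyz⟩ := hshare (g i ^ (m * 2) + g j ^ (m * 2) * (g j - 1))
    (add_mem (Ideal.pow_mem_pow (hg i) _) (Ideal.mul_mem_right _ _ (Ideal.pow_mem_pow (hg j) _)))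
  have h1 := irr k (m * 2) (by omega)
  have h2 : (X : k[X][X]) ^ (m * 2) + C (X ^ (m * 2) * (X - C 1)) = ψ y * ψ z := by
    rw [← map_mul, ← hyz]
    simp [hψi, hψj]
  rcases h1.isUnit_or_isUnit h2 with h | h
  · exact hker y hy h
  · exact hker z hz h

lemma principal
    (A B : Type) [CommRing A] [CommRing B]
    (π : A →+* B) (s : B →+* A) (hs : π.comp s = RingHom.id B)
    (σ : Type) [Unique σ] (e : A ≃+* MvPolynomial σ B) (he : ∀ b : B, e (s b) = MvPolynomial.C b) :
    ∃ g : A, RingHom.ker π = Ideal.span {g} ∧ ∀ x, g * x = 0 → x = 0 := by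
  have hs' : ∀ b, π (s b) = b := fun b => RingHom.congr_fun hs b
  let e' : A ≃+* B[X] := e.trans (MvPolynomial.uniqueAlgEquiv B σ).toRingEquiv
  have he' : ∀ b, e'.symm (C b) = s b := by
    intro b
    rw [RingEquiv.symm_apply_eq]
    simp [e', he]
  let b := π (e'.symm X)
  have hev : ∀ P : B[X], π (e'.symm P) = P.eval b := by
    have : π.comp e'.symm.toRingHom = evalRingHom b := by
      apply Polynomial.ringHom_ext
      · intro c
        show π (e'.symm (C c)) = _
        simp [he', hs']
      · show π (e'.symm X) = _
        simp [b]
    exact fun P => RingHom.congr_fun this P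
  refine ⟨e'.symm (X - C b), ?_, ?_⟩
  · ext x
    obtain ⟨P, rfl⟩ := e'.symm.surjective x
    rw [RingHom.mem_ker, hev, Ideal.mem_span_singleton, map_dvd_iff, dvd_iff_isRoot]
    rfl
  · intro x hx
    obtain ⟨P, rfl⟩ := e'.symm.surjective x
    rw [← map_mul, map_eq_zero_iff _ e'.symm.injective] at hx
    rw [(monic_X_sub_C b).mul_right_eq_zero_iff.1 hx, map_zero]

end

end TorAux

/-- Let `π : A → B` be a surjective ring map with kernel `K`, split by a section
`s : B → A` exhibiting `A` as a polynomial algebra over `B`.  If `m` has the sharing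
property that every element of `K^{m n}` factors as a product of an element of `K^m`
and an element of `K^{m(n-1)}`, then for `p ≥ 1` and `n ≥ 2` the map
`Tor_p^A(A/K^m, A/(K^m)^n) → Tor_p^A(A/K^m, A/(K^m)^{n-1})` induced by the quotient
is zero. -/
theorem tor_map_of_quotient_eq_zero
    (A B : Type) [CommRing A] [CommRing B]
    (π : A →+* B) (hπ : Function.Surjective π)
    (K : Ideal A) (hK : K = RingHom.ker π)
    (s : B →+* A) (hs : π.comp s = RingHom.id B)
    (hfree : ∃ (σ : Type) (e : A ≃+* MvPolynomial σ B),
        ∀ b : B, e (s b) = MvPolynomial.C b)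
    (m : ℕ) (hm : 0 < m)
    (hshare : ∀ n : ℕ, 1 ≤ n → ∀ x ∈ K ^ (m * n),
        ∃ y ∈ K ^ m, ∃ z ∈ K ^ (m * (n - 1)), x = y * z)
    (p n : ℕ) (hp : 1 ≤ p) (hn : 2 ≤ n)
    (f : ModuleCat.of A (A ⧸ (K ^ m) ^ n) ⟶ ModuleCat.of A (A ⧸ (K ^ m) ^ (n - 1)))
    (hf : ∀ a : A, f (Ideal.Quotient.mk ((K ^ m) ^ n) a) =
        Ideal.Quotient.mk ((K ^ m) ^ (n - 1)) a) :
    ((Tor (ModuleCat A) p).obj (ModuleCat.of A (A ⧸ K ^ m))).map f = 0 := by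
  subst hK
  obtain ⟨σ, e, he⟩ := hfree
  obtain ⟨q, rfl⟩ : ∃ q, p = q + 1 := ⟨p - 1, by omega⟩
  have hproj : Projective (ModuleCat.of A (A ⧸ (RingHom.ker π ^ m) ^ (n - 1))) →
      ((Tor (ModuleCat A) (q + 1)).obj (ModuleCat.of A (A ⧸ RingHom.ker π ^ m))).map f = 0 := by
    intro _
    exact (isZero_Tor_succ_of_projective _ _ _ q).eq_of_tgt _ _
  rcases subsingleton_or_nontrivial B with hB | hB
  · have hA : Subsingleton A := e.toEquiv.subsingleton
    apply hproj
    have : Subsingleton (A ⧸ (RingHom.ker π ^ m) ^ (n - 1)) :=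
      Ideal.Quotient.mk_surjective.subsingleton
    infer_instance
  have hσ : Subsingleton σ := by
    refine TorAux.subsingleton_of_share A B π s hs σ e he m hm ?_
    simpa using hshare 2 (by norm_num)
  rcases isEmpty_or_nonempty σ with h0 | ⟨⟨i⟩⟩
  · have hbot : (RingHom.ker π ^ m) ^ (n - 1) = ⊥ := by
      have : RingHom.ker π = ⊥ := by
        rw [eq_bot_iff]
        intro x hx
        obtain ⟨b, hb⟩ := MvPolynomial.C_surjective σ (e x)
        rw [← he, e.injective.eq_iff] at hb
        subst hb
        have h1 : π (s b) = b := RingHom.congr_fun hs b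
        rw [RingHom.mem_ker, h1] at hx
        simp [hx]
      rw [this, ← Ideal.zero_eq_bot, zero_pow hm.ne', zero_pow (by omega)]
    apply hproj
    have : Module.Projective A (A ⧸ (RingHom.ker π ^ m) ^ (n - 1)) :=
      Module.Projective.of_equiv (Submodule.quotEquivOfEqBot _ hbot).symm
    infer_instance
  · have : Unique σ := ⟨⟨i⟩, fun j => Subsingleton.elim _ _⟩
    obtain ⟨g, hg, hreg⟩ := TorAux.principal A B π s hs σ e he
    have hpow : ∀ N : ℕ, ∀ x, g ^ N * x = 0 → x = 0 := by
      intro N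
      induction N with
      | zero => intro x hx; simpa using hx
      | succ N ih =>
        intro x hx
        rw [pow_succ, mul_assoc] at hx
        exact hreg _ (ih _ hx)
    refine TorAux.tor_zero (g ^ (m * n)) (g ^ (m * (n - 1))) (g ^ m) ?_ (hpow _) (hpow _) _ _ _
      ?_ ?_ (Ideal.pow_mem_pow ?_ m) f hf (q + 1) hp
    · obtain ⟨r, rfl⟩ : ∃ r, n = r + 1 := ⟨n - 1, by omega⟩
      rw [← pow_add]
      rfl
    · rw [hg, ← pow_mul, Ideal.span_singleton_pow]
    · rw [hg, ← pow_mul, Ideal.span_singleton_pow]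
    · rw [hg]
      exact Ideal.mem_span_singleton_self g
end

section
/- Let A be a ring and let E'• and E''• be simplicial A-modules such that π_i(E'•) = 0 for i ≤ m and π_i(E''•) = 0 for i ≤ n, and suppose that in each degree one of E'• or E''• is projective (hence flat). Then π_i(E'• ⊗_A E''•) = 0 for all i ≤ m + n + 1. -/
open CategoryTheory CategoryTheory.Limits AlgebraicTopology
open scoped MonoidalCategory

namespace TensorVanish
open Simplicial Opposite

section Shift

/-- The map `[0] ⋆ f`. -/
def shMap {x y : SimplexCategory} (f : x ⟶ y) :
    SimplexCategory.mk (x.len + 1) ⟶ SimplexCategory.mk (y.len + 1) :=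
  SimplexCategory.mkHom
    { toFun := Fin.cases 0 (fun i => (f.toOrderHom i).succ)
      monotone' := by
        intro a b hab
        induction a using Fin.cases with
        | zero => simp
        | succ a =>
          induction b using Fin.cases with
          | zero => simp at hab
          | succ b =>
            simp only [Fin.cases_succ, Fin.succ_le_succ_iff] at hab ⊢
            exact f.toOrderHom.monotone hab }

lemma shMap_zero {x y : SimplexCategory} (f : x ⟶ y) :
    (shMap f).toOrderHom 0 = 0 := rfl

lemma shMap_succ {x y : SimplexCategory} (f : x ⟶ y) (i : Fin (x.len + 1)) :
    (shMap f).toOrderHom i.succ = (f.toOrderHom i).succ := rfl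

lemma hom_ext_val {x y : SimplexCategory} (f g : x ⟶ y)
    (h : ∀ i : Fin (x.len + 1), (f.toOrderHom i).val = (g.toOrderHom i).val) : f = g := by
  ext i
  exact h i

/-- The shift functor `[n] ↦ [0] ⋆ [n]`. -/
def Sh : SimplexCategory ⥤ SimplexCategory where
  obj x := SimplexCategory.mk (x.len + 1)
  map f := shMap f
  map_id x := by
    apply hom_ext_val
    intro i
    induction i using Fin.cases with
    | zero => rfl
    | succ i => rfl
  map_comp f g := by
    apply hom_ext_val
    intro i
    induction i using Fin.cases with
    | zero => rfl
    | succ i => rfl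

/-- The inclusion `[n] → [0] ⋆ [n]`. -/
def shIncl : 𝟭 SimplexCategory ⟶ Sh where
  app x := SimplexCategory.δ (n := x.len) 0
  naturality x y f := by
    apply hom_ext_val
    intro i
    rfl

/-- The constant endomorphism of `[0] ⋆ [n]`. -/
def shConst : Sh ⟶ Sh where
  app x := SimplexCategory.const _ _ 0
  naturality x y f := by
    apply hom_ext_val
    intro i
    rfl

/-- The maps defining the homotopy. -/
def eta {n : ℕ} (i : Fin (n + 1)) : ⦋n + 1 + 1⦌ ⟶ ⦋n + 1⦌ :=
  SimplexCategory.mkHom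
    { toFun := fun p => if p.val ≤ i.val + 1 then 0 else ⟨p.val - 1, by omega⟩
      monotone' := by
        intro a b hab
        have : a.val ≤ b.val := hab
        dsimp only
        split_ifs <;> simp [Fin.le_def] <;> omega }

lemma eta_val {n : ℕ} (i : Fin (n + 1)) (p : Fin (n + 3)) :
    ((eta i).toOrderHom p).val = if p.val ≤ i.val + 1 then 0 else p.val - 1 := by
  change (if p.val ≤ i.val + 1 then (0 : Fin (n + 2)) else ⟨p.val - 1, by omega⟩ : Fin (n+2)).val = _
  split_ifs <;> rfl

lemma delta_val {n : ℕ} (i : Fin (n + 2)) (p : Fin (n + 1)) :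
    ((SimplexCategory.δ i).toOrderHom p).val = if p.val < i.val then p.val else p.val + 1 := by
  change (Fin.succAbove i p).val = _
  simp only [Fin.succAbove, Fin.lt_def]
  split_ifs <;> simp_all

lemma sigma_val {n : ℕ} (i : Fin (n + 1)) (p : Fin (n + 2)) :
    ((SimplexCategory.σ i).toOrderHom p).val = if p.val ≤ i.val then p.val else p.val - 1 := by
  change (Fin.predAbove i p).val = _
  simp only [Fin.predAbove, Fin.lt_def, Fin.val_castSucc]
  split_ifs <;> simp_all <;> omega

lemma shMap_val {x y : SimplexCategory} (f : x ⟶ y) (p : Fin (x.len + 2)) :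
    ((shMap f).toOrderHom p).val =
      if h : p.val = 0 then 0 else (f.toOrderHom ⟨p.val - 1, by omega⟩).val + 1 := by
  induction p using Fin.cases with
  | zero => rfl
  | succ p => simp [shMap_succ]

lemma shDelta_val {n : ℕ} (i : Fin (n + 2)) (p : Fin (n + 2)) :
    ((shMap (SimplexCategory.δ i)).toOrderHom p).val =
      if p.val < i.val + 1 then p.val else p.val + 1 := by
  refine (shMap_val _ p).trans ?_
  split_ifs
  · omega
  · omega
  · rw [delta_val]; dsimp only; split_ifs <;> omega
  · rw [delta_val]; dsimp only; split_ifs <;> omega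

lemma shSigma_val {n : ℕ} (i : Fin (n + 1)) (p : Fin (n + 3)) :
    ((shMap (SimplexCategory.σ i)).toOrderHom p).val =
      if p.val ≤ i.val + 1 then p.val else p.val - 1 := by
  refine (shMap_val _ p).trans ?_
  split_ifs
  · omega
  · omega
  · rw [sigma_val]; dsimp only; split_ifs <;> omega
  · rw [sigma_val]; dsimp only; split_ifs <;> omega

lemma comp_val {x y z : SimplexCategory} (f : x ⟶ y) (g : y ⟶ z) (p : Fin (x.len + 1)) :
    ((f ≫ g).toOrderHom p).val = (g.toOrderHom (f.toOrderHom p)).val := rfl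

/-- `[0] ⋆ δ i`. -/
def shD {n : ℕ} (i : Fin (n + 2)) : ⦋n + 1⦌ ⟶ ⦋n + 1 + 1⦌ := shMap (SimplexCategory.δ i)

/-- `[0] ⋆ σ i`. -/
def shS {n : ℕ} (i : Fin (n + 1)) : ⦋n + 1 + 1⦌ ⟶ ⦋n + 1⦌ := shMap (SimplexCategory.σ i)

lemma shD_val {n : ℕ} (i : Fin (n + 2)) (p : Fin (n + 2)) :
    ((shD i).toOrderHom p).val = if p.val < i.val + 1 then p.val else p.val + 1 :=
  shDelta_val i p

lemma shS_val {n : ℕ} (i : Fin (n + 1)) (p : Fin (n + 3)) :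
    ((shS i).toOrderHom p).val = if p.val ≤ i.val + 1 then p.val else p.val - 1 :=
  shSigma_val i p

lemma hom_ext_val' {a b : ℕ} (f g : ⦋a⦌ ⟶ ⦋b⦌)
    (h : ∀ i : Fin (a + 1), (f.toOrderHom i).val = (g.toOrderHom i).val) : f = g :=
  hom_ext_val f g h

lemma comp_val' {a b c : ℕ} (f : ⦋a⦌ ⟶ ⦋b⦌) (g : ⦋b⦌ ⟶ ⦋c⦌) (p : Fin (a + 1)) :
    ((f ≫ g).toOrderHom p).val = (g.toOrderHom (f.toOrderHom p : Fin (b + 1))).val := rfl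

lemma eta_1 (n : ℕ) : shD (n := n) 0 ≫ eta 0 = 𝟙 _ := by
  apply hom_ext_val'
  intro p
  rw [comp_val', eta_val, shD_val]
  change _ = p.val
  have h1 : ((0 : Fin (n + 1)) : ℕ) = 0 := rfl
  have h2 : ((0 : Fin (n + 2)) : ℕ) = 0 := rfl
  split_ifs <;> omega

lemma eta_2 (n : ℕ) : shD (n := n) (Fin.last (n + 1)) ≫ eta (Fin.last n) =
    SimplexCategory.const _ _ 0 := by
  apply hom_ext_val'
  intro p
  rw [comp_val', eta_val, shD_val]
  change _ = 0
  simp only [Fin.val_last]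
  split_ifs <;> omega

lemma eta_3 {n : ℕ} (i : Fin (n + 2)) (j : Fin (n + 1)) (hij : i ≤ j.castSucc) :
    shD i.castSucc ≫ eta j.succ = eta j ≫ shD i := by
  apply hom_ext_val'
  intro p
  rw [comp_val', comp_val', eta_val, shD_val, shD_val, eta_val]
  simp only [Fin.val_castSucc, Fin.val_succ, Fin.le_def] at hij ⊢
  split_ifs <;> omega

lemma eta_4 {n : ℕ} (j : Fin (n + 1)) :
    shD j.castSucc.succ ≫ eta j.succ = shD j.castSucc.succ ≫ eta j.castSucc := by
  apply hom_ext_val'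
  intro p
  rw [comp_val', comp_val', eta_val, shD_val, eta_val, shD_val]
  simp only [Fin.val_castSucc, Fin.val_succ]
  split_ifs <;> omega

lemma eta_5 {n : ℕ} (i : Fin (n + 2)) (j : Fin (n + 1)) (hji : j.castSucc < i) :
    shD i.succ ≫ eta j.castSucc = eta j ≫ shD i := by
  apply hom_ext_val'
  intro p
  rw [comp_val', comp_val', eta_val, shD_val, shD_val, eta_val]
  simp only [Fin.val_castSucc, Fin.val_succ, Fin.lt_def] at hji ⊢
  split_ifs <;> omega

lemma eta_6 {n : ℕ} (i j : Fin (n + 1)) (hij : i ≤ j) :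
    shS i.castSucc ≫ eta j = eta j.succ ≫ shS i := by
  apply hom_ext_val'
  intro p
  rw [comp_val', comp_val', eta_val, shS_val, shS_val, eta_val]
  simp only [Fin.val_castSucc, Fin.val_succ, Fin.le_def] at hij ⊢
  split_ifs <;> omega

lemma eta_7 {n : ℕ} (i j : Fin (n + 1)) (hji : j ≤ i) :
    shS i.succ ≫ eta j = eta j.castSucc ≫ shS i := by
  apply hom_ext_val'
  intro p
  rw [comp_val', comp_val', eta_val, shS_val, shS_val, eta_val]
  simp only [Fin.val_castSucc, Fin.val_succ, Fin.le_def] at hji ⊢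
  split_ifs <;> omega

end Shift

section Dec
variable {C : Type*} [Category C] (E : SimplicialObject C)

/-- The décalage. -/
abbrev Dec : SimplicialObject C := Sh.op ⋙ E

/-- The dropped face. -/
abbrev decD : Dec E ⟶ E := Functor.whiskerRight (NatTrans.op shIncl) E

/-- The idempotent. -/
abbrev decE : Dec E ⟶ Dec E := Functor.whiskerRight (NatTrans.op shConst) E

lemma map_eq_of {x y : SimplexCategory} {f g : x ⟶ y} (h : f = g) : E.map f.op = E.map g.op := by
  rw [h]

/-- The contraction of the décalage. -/
def decHomotopy : SimplicialObject.Homotopy (decE E) (𝟙 (Dec E)) where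
  h i := E.map (eta i).op
  h_zero_comp_δ_zero n :=
    (E.map_comp _ _).symm.trans (Eq.trans (map_eq_of E (eta_1 n)) (E.map_id _))
  h_last_comp_δ_last n := (E.map_comp _ _).symm.trans (map_eq_of E (eta_2 n))
  h_succ_comp_δ_castSucc_of_lt i j h :=
    (E.map_comp _ _).symm.trans (Eq.trans (map_eq_of E (eta_3 i j h)) (E.map_comp _ _))
  h_succ_comp_δ_castSucc_succ j :=
    (E.map_comp _ _).symm.trans (Eq.trans (map_eq_of E (eta_4 j)) (E.map_comp _ _))
  h_castSucc_comp_δ_succ_of_lt i j h :=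
    (E.map_comp _ _).symm.trans (Eq.trans (map_eq_of E (eta_5 i j h)) (E.map_comp _ _))
  h_comp_σ_castSucc_of_le i j h :=
    (E.map_comp _ _).symm.trans (Eq.trans (map_eq_of E (eta_6 i j h)) (E.map_comp _ _))
  h_comp_σ_succ_of_lt i j h :=
    (E.map_comp _ _).symm.trans (Eq.trans (map_eq_of E (eta_7 i j h)) (E.map_comp _ _))

lemma decE_idem : decE E ≫ decE E = decE E := by
  apply NatTrans.ext
  funext k
  refine (E.map_comp _ _).symm.trans (map_eq_of E ?_)
  apply hom_ext_val
  intro p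
  rfl

end Dec

section TensorHomotopy
variable {C : Type*} [Category C] [MonoidalCategory C]
variable {X Y X' Y' : SimplexCategoryᵒᵖ ⥤ C} {f g : X ⟶ Y} {f' g' : X' ⟶ Y'}

open MonoidalCategory

/-- Tensor product of simplicial homotopies. -/
def tensorHomotopy (H : SimplicialObject.Homotopy f g) (H' : SimplicialObject.Homotopy f' g') :
    SimplicialObject.Homotopy (X := X ⊗ X') (Y := Y ⊗ Y') (f ⊗ₘ f') (g ⊗ₘ g') where
  h i := H.h i ⊗ₘ H'.h i
  h_zero_comp_δ_zero n := (tensorHom_comp_tensorHom _ _ _ _).trans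
    (congrArg₂ _ (H.h_zero_comp_δ_zero n) (H'.h_zero_comp_δ_zero n))
  h_last_comp_δ_last n := (tensorHom_comp_tensorHom _ _ _ _).trans
    (congrArg₂ _ (H.h_last_comp_δ_last n) (H'.h_last_comp_δ_last n))
  h_succ_comp_δ_castSucc_of_lt i j hij := (tensorHom_comp_tensorHom _ _ _ _).trans
    ((congrArg₂ _ (H.h_succ_comp_δ_castSucc_of_lt i j hij)
      (H'.h_succ_comp_δ_castSucc_of_lt i j hij)).trans (tensorHom_comp_tensorHom _ _ _ _).symm)
  h_succ_comp_δ_castSucc_succ j := (tensorHom_comp_tensorHom _ _ _ _).trans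
    ((congrArg₂ _ (H.h_succ_comp_δ_castSucc_succ j)
      (H'.h_succ_comp_δ_castSucc_succ j)).trans (tensorHom_comp_tensorHom _ _ _ _).symm)
  h_castSucc_comp_δ_succ_of_lt i j hij := (tensorHom_comp_tensorHom _ _ _ _).trans
    ((congrArg₂ _ (H.h_castSucc_comp_δ_succ_of_lt i j hij)
      (H'.h_castSucc_comp_δ_succ_of_lt i j hij)).trans (tensorHom_comp_tensorHom _ _ _ _).symm)
  h_comp_σ_castSucc_of_le i j hij := (tensorHom_comp_tensorHom _ _ _ _).trans
    ((congrArg₂ _ (H.h_comp_σ_castSucc_of_le i j hij)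
      (H'.h_comp_σ_castSucc_of_le i j hij)).trans (tensorHom_comp_tensorHom _ _ _ _).symm)
  h_comp_σ_succ_of_lt i j hij := (tensorHom_comp_tensorHom _ _ _ _).trans
    ((congrArg₂ _ (H.h_comp_σ_succ_of_lt i j hij)
      (H'.h_comp_σ_succ_of_lt i j hij)).trans (tensorHom_comp_tensorHom _ _ _ _).symm)

end TensorHomotopy

section Main
universe u
variable {A : Type u} [CommRing A]
open MonoidalCategory

variable (E F : SimplexCategoryᵒᵖ ⥤ ModuleCat.{u} A)

/-- The alternating face map complex. -/
noncomputable abbrev KK : ChainComplex (ModuleCat.{u} A) ℕ :=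
  (alternatingFaceMapComplex (ModuleCat.{u} A)).obj E

/-- `decE` as a morphism of functors. -/
abbrev ee : (Sh.op ⋙ E) ⟶ (Sh.op ⋙ E) := decE E

/-- The path object. -/
noncomputable abbrev PP : SimplexCategoryᵒᵖ ⥤ ModuleCat.{u} A := kernel (ee E)

/-- The inclusion of the path object. -/
noncomputable abbrev pI : PP E ⟶ Sh.op ⋙ E := kernel.ι (ee E)

lemma ee_idem : ee E ≫ ee E = ee E := decE_idem E

/-- The retraction on the path object. -/
noncomputable abbrev pR : Sh.op ⋙ E ⟶ PP E :=
  kernel.lift (ee E) (𝟙 _ - ee E) (by rw [Preadditive.sub_comp, ee_idem, Category.id_comp, sub_self])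

lemma pI_ee : pI E ≫ ee E = 0 := kernel.condition _

lemma pR_pI : pR E ≫ pI E = 𝟙 _ - ee E := kernel.lift_ι _ _ _

lemma pI_pR : pI E ≫ pR E = 𝟙 _ := by
  rw [← cancel_mono (pI E), Category.assoc, pR_pI, Preadditive.comp_sub, pI_ee]
  simp

/-- The path fibration. -/
noncomputable abbrev pQ : PP E ⟶ E := pI E ≫ decD E

/-- The loop object. -/
noncomputable abbrev LL : SimplexCategoryᵒᵖ ⥤ ModuleCat.{u} A := kernel (pQ E)

/-- The path-loop sequence. -/
noncomputable abbrev SS : ShortComplex (SimplexCategoryᵒᵖ ⥤ ModuleCat.{u} A) :=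
  ShortComplex.mk (kernel.ι (pQ E)) (pQ E) (kernel.condition _)

lemma whiskerLeft_zero' {X Y : SimplexCategoryᵒᵖ ⥤ ModuleCat.{u} A} :
    F ◁ (0 : X ⟶ Y) = 0 := by
  apply NatTrans.ext
  funext k
  exact MonoidalPreadditive.whiskerLeft_zero (C := ModuleCat.{u} A) (X := F.obj k)

lemma isZero_of_homotopy {X : SimplexCategoryᵒᵖ ⥤ ModuleCat.{u} A}
    {f g : X ⟶ X} (H : SimplicialObject.Homotopy f g) (hf : f = 0) (hg : g = 𝟙 X)
    (i : ℕ) : IsZero ((KK X).homology i) := by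
  have h := H.map_homology_eq i
  subst hf hg
  rw [Functor.map_zero, Functor.map_zero] at h
  rw [IsZero.iff_id_eq_zero]
  refine Eq.trans ?_ h.symm
  erw [CategoryTheory.Functor.map_id]
  rfl

lemma isZero_PP (i : ℕ) : IsZero ((KK (PP E)).homology i) := by
  refine isZero_of_homotopy (((decHomotopy E).precomp (pI E)).postcomp (pR E)) ?_ ?_ i
  · exact (congrArg (· ≫ pR E) (pI_ee E)).trans zero_comp
  · exact (congrArg (· ≫ pR E) (Category.comp_id (pI E))).trans (pI_pR E)

lemma isZero_tensor_PP (i : ℕ) : IsZero ((KK (F ⊗ PP E)).homology i) := by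
  refine isZero_of_homotopy
    (((tensorHomotopy (SimplicialObject.Homotopy.refl (𝟙 F)) (decHomotopy E)).precomp
      (F ◁ pI E)).postcomp (F ◁ pR E)) ?_ ?_ i
  · have h1 : (F ◁ pI E ≫ (𝟙 F ⊗ₘ ee E)) ≫ F ◁ pR E = 0 := by
      rw [id_tensorHom, ← whiskerLeft_comp, pI_ee, whiskerLeft_zero', zero_comp]
    exact h1
  · have h1 : (F ◁ pI E ≫ (𝟙 F ⊗ₘ 𝟙 (Sh.op ⋙ E))) ≫ F ◁ pR E = 𝟙 (F ⊗ PP E) := by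
      rw [id_tensorHom, ← whiskerLeft_comp, ← whiskerLeft_comp, Category.comp_id, pI_pR,
        whiskerLeft_id]
    exact h1

lemma shortExact_KK {S : ShortComplex (SimplexCategoryᵒᵖ ⥤ ModuleCat.{u} A)}
    (h : ∀ k, (S.map ((evaluation _ _).obj k)).ShortExact) :
    ((S.map (alternatingFaceMapComplex (ModuleCat.{u} A)))).ShortExact :=
  HomologicalComplex.shortExact_of_degreewise_shortExact _ fun n => h (op ⦋n⦌)

lemma map_comp_apply {x y z : SimplexCategory} (f : x ⟶ y) (g : y ⟶ z) (v : E.obj (op z)) :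
    E.map (f ≫ g).op v = E.map f.op (E.map g.op v) := by
  rw [op_comp, E.map_comp]
  rfl

lemma exists_edge (h0 : IsZero ((KK E).homology 0)) (a : E.obj (op ⦋0⦌)) :
    ∃ e : E.obj (op ⦋1⦌), E.map (SimplexCategory.δ (n := 0) 0).op e = 0 ∧
      E.map (SimplexCategory.δ (n := 0) 1).op e = a := by
  have h1 : (KK E).ExactAt 0 := (HomologicalComplex.exactAt_iff_isZero_homology _ _).2 h0
  rw [HomologicalComplex.exactAt_iff' _ 1 0 0 (by simp) (by simp)] at h1
  have h2 : Epi ((KK E).d 1 0) :=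
    (ShortComplex.exact_iff_epi _ ((KK E).shape 0 0 (by simp))).1 h1
  obtain ⟨(b : E.obj (op ⦋1⦌)), hb⟩ := (ModuleCat.epi_iff_surjective _).1 h2 a
  have hd : (KK E).d 1 0 = E.map (SimplexCategory.δ (n := 0) 0).op -
      E.map (SimplexCategory.δ (n := 0) 1).op := by
    refine (AlternatingFaceMapComplex.obj_d_eq E 0).trans ?_
    rw [Fin.sum_univ_two]
    simp [SimplicialObject.δ, sub_eq_add_neg]
  rw [hd] at hb
  replace hb : E.map (SimplexCategory.δ (n := 0) 0).op b -
    E.map (SimplexCategory.δ (n := 0) 1).op b = a := hb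
  refine ⟨E.map (SimplexCategory.σ (n := 0) 0).op
    (E.map (SimplexCategory.δ (n := 0) 0).op b) - b, ?_, ?_⟩
  · rw [map_sub, ← map_comp_apply, ← map_comp_apply]
    have : SimplexCategory.δ (n := 0) 0 ≫ SimplexCategory.σ (n := 0) 0 = 𝟙 _ := by decide
    rw [this, Category.id_comp, sub_self]
  · rw [map_sub, ← map_comp_apply, ← map_comp_apply]
    have : SimplexCategory.δ (n := 0) 1 ≫ SimplexCategory.σ (n := 0) 0 = 𝟙 _ := by decide
    rw [this, Category.id_comp, hb]

/-- The map collapsing everything but the cone point. -/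
def collapse (n : ℕ) : ⦋n + 1⦌ ⟶ ⦋1⦌ :=
  SimplexCategory.mkHom
    { toFun := fun p => if p = 0 then 0 else 1
      monotone' := by
        intro a b hab
        dsimp only
        split_ifs with h1 h2 h3
        · exact le_rfl
        · exact Fin.zero_le _
        · subst h3
          exact absurd (Fin.le_zero_iff.1 hab) h1
        · exact le_rfl }

lemma exists_lift (h0 : IsZero ((KK E).homology 0)) (n : ℕ) (y : E.obj (op ⦋n⦌)) :
    ∃ x : E.obj (op ⦋n + 1⦌), E.map (SimplexCategory.const ⦋n + 1⦌ ⦋n + 1⦌ 0).op x = 0 ∧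
      E.map (SimplexCategory.δ (n := n) 0).op x = y := by
  obtain ⟨e, he0, he1⟩ := exists_edge E h0
    (E.map (SimplexCategory.const ⦋0⦌ ⦋n + 1⦌ 0).op (E.map (SimplexCategory.σ (n := n) 0).op y))
  refine ⟨E.map (SimplexCategory.σ (n := n) 0).op y - E.map (collapse n).op e, ?_, ?_⟩
  · have h1 : SimplexCategory.const ⦋n + 1⦌ ⦋n + 1⦌ 0 =
        SimplexCategory.const ⦋n + 1⦌ ⦋0⦌ 0 ≫ SimplexCategory.const ⦋0⦌ ⦋n + 1⦌ 0 := rfl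
    have h2 : SimplexCategory.const ⦋n + 1⦌ ⦋n + 1⦌ 0 ≫ collapse n =
        SimplexCategory.const ⦋n + 1⦌ ⦋0⦌ 0 ≫ SimplexCategory.δ (n := 0) 1 := by
      apply hom_ext_val'
      intro p
      rfl
    rw [map_sub, ← map_comp_apply (f := SimplexCategory.const ⦋n + 1⦌ ⦋n + 1⦌ 0)
      (g := collapse n), h2, map_comp_apply E _ (SimplexCategory.δ (n := 0) 1), he1,
      h1, map_comp_apply, sub_self]
  · have h1 : SimplexCategory.δ (n := n) 0 ≫ SimplexCategory.σ (n := n) 0 = 𝟙 _ :=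
      SimplexCategory.δ_comp_σ_self
    have h2 : SimplexCategory.δ (n := n) 0 ≫ collapse n =
        SimplexCategory.const ⦋n⦌ ⦋0⦌ 0 ≫ SimplexCategory.δ (n := 0) 0 := by
      apply hom_ext_val'
      intro p
      rfl
    rw [map_sub, ← map_comp_apply, ← map_comp_apply, h1, h2, map_comp_apply, he0, map_zero,
      sub_zero, op_id, E.map_id]
    rfl

lemma epi_pQ (h0 : IsZero ((KK E).homology 0)) : Epi (pQ E) := by
  rw [NatTrans.epi_iff_epi_app]
  intro k
  rw [ModuleCat.epi_iff_surjective]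
  intro y
  obtain ⟨x, hx1, hx2⟩ := exists_lift E h0 k.unop.len y
  refine ⟨(pR E).app k x, ?_⟩
  have h1 := congrArg (fun t : (Sh.op ⋙ E) ⟶ (Sh.op ⋙ E) => (t.app k).hom x) (pR_pI E)
  replace h1 : (pI E).app k ((pR E).app k x) = x := by
    refine h1.trans ?_
    change x - E.map (SimplexCategory.const ⦋k.unop.len + 1⦌ ⦋k.unop.len + 1⦌ 0).op x = x
    rw [hx1, sub_zero]
  change (decD E).app k ((pI E).app k ((pR E).app k x)) = y
  rw [h1]
  exact hx2

lemma SS_shortExact (h0 : IsZero ((KK E).homology 0)) : (SS E).ShortExact := by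
  have := epi_pQ E h0
  exact { exact := ShortComplex.exact_of_f_is_kernel _ (kernelIsKernel _) }

lemma SS_eval (h0 : IsZero ((KK E).homology 0)) (k) :
    ((SS E).map ((evaluation _ _).obj k)).ShortExact :=
  (SS_shortExact E h0).map_of_exact _

lemma projective_PP (k) (h : ∀ k, Projective (E.obj k)) : Projective ((PP E).obj k) := by
  have : Projective ((Sh.op ⋙ E).obj k) := h _
  refine Retract.projective (Y := (Sh.op ⋙ E).obj k) ⟨(pI E).app k, (pR E).app k, ?_⟩
  exact congrArg (fun t => NatTrans.app t k) (pI_pR E)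

lemma projective_LL (h0 : IsZero ((KK E).homology 0)) (h : ∀ k, Projective (E.obj k)) (k) :
    Projective ((LL E).obj k) := by
  have := projective_PP E k h
  have : Projective ((SS E).map ((evaluation _ _).obj k)).X₃ := h k
  let s := (SS_eval E h0 k).splittingOfProjective
  exact Retract.projective (Y := (PP E).obj k) ⟨_, s.r, s.f_r⟩

lemma step_loop (h0 : IsZero ((KK E).homology 0)) (i : ℕ) (hi : IsZero ((KK E).homology (i + 1))) :
    IsZero ((KK (LL E)).homology i) := by
  have hS := shortExact_KK (SS_eval E h0)
  exact hi.of_iso (hS.δIso (i + 1) i (by simp) (isZero_PP E _) (isZero_PP E _)).symm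

lemma tensor_eval (h0 : IsZero ((KK E).homology 0))
    (hp : (∀ k, Projective (F.obj k)) ∨ (∀ k, Projective (E.obj k))) (k) :
    (((SS E).map ((evaluation _ _).obj k)).map (tensorLeft (F.obj k))).ShortExact := by
  rcases hp with hp | hp
  · have := hp k
    have : Module.Projective A (F.obj k) := (IsProjective.iff_projective _).2 this
    exact (SS_eval E h0 k).map_of_exact _
  · have : Projective ((SS E).map ((evaluation _ _).obj k)).X₃ := hp k
    exact ((SS_eval E h0 k).splittingOfProjective.map (tensorLeft (F.obj k))).shortExact

/-- The tensored path-loop sequence. -/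
noncomputable abbrev TS : ShortComplex (SimplexCategoryᵒᵖ ⥤ ModuleCat.{u} A) :=
  ShortComplex.mk (F ◁ kernel.ι (pQ E)) (F ◁ pQ E)
    (by rw [← whiskerLeft_comp, kernel.condition, whiskerLeft_zero'])

lemma TS_KK (h0 : IsZero ((KK E).homology 0))
    (hp : (∀ k, Projective (F.obj k)) ∨ (∀ k, Projective (E.obj k))) :
    ((TS E F).map (alternatingFaceMapComplex (ModuleCat.{u} A))).ShortExact :=
  shortExact_KK fun k => tensor_eval E F h0 hp k

lemma step_zero (h0 : IsZero ((KK E).homology 0))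
    (hp : (∀ k, Projective (F.obj k)) ∨ (∀ k, Projective (E.obj k))) :
    IsZero ((KK (F ⊗ E)).homology 0) := by
  have hS := TS_KK E F h0 hp
  have := hS.epi_g
  have h1 : Epi (HomologicalComplex.homologyMap
      ((TS E F).map (alternatingFaceMapComplex (ModuleCat.{u} A))).g 0) :=
    HomologicalComplex.epi_homologyMap_of_epi_of_not_rel _ _ (by simp)
  exact @IsZero.of_epi _ _ _ _ _ _ h1 (isZero_tensor_PP E F 0)

lemma step_succ (h0 : IsZero ((KK E).homology 0))
    (hp : (∀ k, Projective (F.obj k)) ∨ (∀ k, Projective (E.obj k))) (i : ℕ)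
    (hi : IsZero ((KK (F ⊗ LL E)).homology i)) :
    IsZero ((KK (F ⊗ E)).homology (i + 1)) := by
  have hS := TS_KK E F h0 hp
  exact hi.of_iso
    (hS.δIso (i + 1) i (by simp) (isZero_tensor_PP E F _) (isZero_tensor_PP E F _))

lemma vanish_one (m : ℕ) (G : SimplexCategoryᵒᵖ ⥤ ModuleCat.{u} A) :
    ∀ F : SimplexCategoryᵒᵖ ⥤ ModuleCat.{u} A, (∀ k, Projective (F.obj k)) →
    (∀ i < m, IsZero ((KK F).homology i)) → ∀ i < m, IsZero ((KK (G ⊗ F)).homology i) := by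
  induction m with
  | zero => intro F _ _ i hi; omega
  | succ m ih =>
    intro F hF h i hi
    have h0 := h 0 (by omega)
    cases i with
    | zero => exact step_zero F G h0 (Or.inr hF)
    | succ i =>
      refine step_succ F G h0 (Or.inr hF) i (ih _ (projective_LL F h0 hF) ?_ i (by omega))
      intro j hj
      exact step_loop F h0 j (h _ (by omega))

lemma isZero_braid (i : ℕ) (h : IsZero ((KK (E ⊗ F)).homology i)) :
    IsZero ((KK (F ⊗ E)).homology i) :=
  h.of_iso ((HomologicalComplex.homologyFunctor _ _ i).mapIso
    ((alternatingFaceMapComplex (ModuleCat.{u} A)).mapIso (β_ F E)))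

lemma vanish_two (m n : ℕ) (F : SimplexCategoryᵒᵖ ⥤ ModuleCat.{u} A)
    (hF : ∀ k, Projective (F.obj k)) (hm : ∀ i < m, IsZero ((KK F).homology i)) :
    ∀ E : SimplexCategoryᵒᵖ ⥤ ModuleCat.{u} A, (∀ i < n, IsZero ((KK E).homology i)) →
    ∀ i < m + n, IsZero ((KK (F ⊗ E)).homology i) := by
  induction n with
  | zero =>
    intro E _ i hi
    exact isZero_braid _ _ i (vanish_one m E F hF hm i hi)
  | succ n ih =>
    intro E h i hi
    have h0 := h 0 (by omega)
    cases i with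
    | zero => exact step_zero E F h0 (Or.inl hF)
    | succ i =>
      refine step_succ E F h0 (Or.inl hF) i (ih _ ?_ i (by omega))
      intro j hj
      exact step_loop E h0 j (h _ (by omega))

/-- Comparison of the two complexes. -/
lemma isZero_iff (i : ℕ) :
    IsZero (((normalizedMooreComplex (ModuleCat.{u} A)).obj E).homology i) ↔
      IsZero ((KK E).homology i) :=
  ((DoldKan.homotopyEquivNormalizedMooreComplexAlternatingFaceMapComplex (Y := E)).toHomologyIso
    i).isZero_iff

end Main
end TensorVanish

/-- If `E'` and `E''` are simplicial modules over `A` with `π_i E' = 0` for `i ≤ m` and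
`π_i E'' = 0` for `i ≤ n` (homotopy computed as homology of the normalized Moore
complex), and one of them is levelwise projective, then the levelwise tensor product
`E' ⊗ E''` has `π_i (MonoidalCategory.tensorObj (C := SimplexCategoryᵒᵖ ⥤ ModuleCat A) E' E'') = 0` for `i ≤ m + n + 1`. -/
theorem homotopy_vanishing_of_tensor_of_simplicial_modules
    (A : Type) [CommRing A]
    (E' E'' : SimplexCategoryᵒᵖ ⥤ ModuleCat A) (m n : ℕ)
    (h' : ∀ i : ℕ, i ≤ m →
      IsZero (((normalizedMooreComplex (ModuleCat A)).obj E').homology i))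
    (h'' : ∀ i : ℕ, i ≤ n →
      IsZero (((normalizedMooreComplex (ModuleCat A)).obj E'').homology i))
    (hproj : (∀ k : SimplexCategoryᵒᵖ, Projective (E'.obj k)) ∨
      (∀ k : SimplexCategoryᵒᵖ, Projective (E''.obj k))) :
    ∀ i : ℕ, i ≤ m + n + 1 →
      IsZero (((normalizedMooreComplex (ModuleCat A)).obj (MonoidalCategory.tensorObj (C := SimplexCategoryᵒᵖ ⥤ ModuleCat A) E' E'')).homology i) := by
  intro i hi
  rw [TensorVanish.isZero_iff]
  simp only [TensorVanish.isZero_iff] at h' h''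
  rcases hproj with hp | hp
  · exact TensorVanish.vanish_two (m + 1) (n + 1) E' hp (fun j hj => h' j (by omega)) E''
      (fun j hj => h'' j (by omega)) i (by omega)
  · exact TensorVanish.isZero_braid _ _ i
      (TensorVanish.vanish_two (n + 1) (m + 1) E'' hp (fun j hj => h'' j (by omega)) E'
        (fun j hj => h' j (by omega)) i (by omega))
end
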